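/- There exist a universal constant c > 0 and ε₀ ∈ (0,1) such that for every 0 < ε < ε₀, every λ ∈ [0, λ_c] and every m ∈ H¹(𝕋²; S²) one has F_{ε,λ}[m] ≥ (1 − λ|log(cε)|/(λ_c |log ε|)) ∫_{𝕋²} |∇m₃| dx. -/

import Mathlib

open MeasureTheory Real Filter

noncomputable section

/-- The plane `ℝ²`, modeled as functions `Fin 2 → ℝ`. -/
abbrev R2 : Type := Fin 2 → ℝ

/-- The target space `ℝ³`. -/
abbrev R3 : Type := Fin 3 → ℝ

/-- A fundamental domain for the unit torus `𝕋² = ℝ²/ℤ²`. -/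
def cube : Set R2 := Set.univ.pi fun _ => Set.Ico (0 : ℝ) 1

/-- The Euclidean norm on `ℝ²`. -/
def en2 (z : R2) : ℝ := Real.sqrt (∑ i, z i ^ 2)

/-- The Euclidean norm on `ℝ³`. -/
def en3 (v : R3) : ℝ := Real.sqrt (∑ i, v i ^ 2)

/-- `|∇f(x)|²` for a scalar function. -/
def gradNormSq (f : R2 → ℝ) (x : R2) : ℝ :=
  ∑ j, (fderiv ℝ f x (Pi.single j 1)) ^ 2

/-- `|∇f(x)|` for a scalar function. -/
def gradNorm (f : R2 → ℝ) (x : R2) : ℝ := Real.sqrt (gradNormSq f x)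

/-- `|∇m(x)|²` for a map `m : ℝ² → ℝ³` (Frobenius norm squared). -/
def gradVSq (m : R2 → R3) (x : R2) : ℝ :=
  ∑ j, ∑ i, (fderiv ℝ m x (Pi.single j 1) i) ^ 2

/-- The squared homogeneous `H^{1/2}` seminorm on the torus (real-space formula). -/
def H12 (f : R2 → ℝ) : ℝ :=
  (1 / (4 * π)) * ∫ x in cube, ∫ z : R2, (f (x + z) - f x) ^ 2 / en2 z ^ 3

/-- A (strong) magnetization in `H¹(𝕋²; S²)`: a continuously differentiable
`ℤ²`-periodic map with values in the unit sphere `S² ⊂ ℝ³`. -/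
def Mag (m : R2 → R3) : Prop :=
  ContDiff ℝ 1 m ∧
    (∀ (x : R2) (n : Fin 2 → ℤ), m (x + fun i => (n i : ℝ)) = m x) ∧
    ∀ x, ∑ i, (m x i) ^ 2 = 1

/-- The reduced thin-film energy `F_{ε,λ}`. -/
def Fen (ε lam : ℝ) (m : R2 → R3) : ℝ :=
  (∫ x in cube, (ε / 2 * gradVSq m x + (1 - (m x 2) ^ 2) / (2 * ε)))
    - lam / |Real.log ε| * H12 (fun x => m x 2)

/-- The north pole `e₃ = (0,0,1)`. -/
def e3 : R3 := ![0, 0, 1]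

open scoped ENNReal Pointwise

lemma polar_le (F : R2 → ℝ≥0∞) (g h : ℝ → ℝ≥0∞) (hg : Measurable g) (hh : Measurable h)
    (H : ∀ r θ : ℝ, 0 < r →
      ENNReal.ofReal r * F ![r * cos θ, r * sin θ] ≤ g r * h θ) :
    ∫⁻ z, F z ≤ (∫⁻ r in Set.Ioi (0:ℝ), g r) * ∫⁻ θ in Set.Ioo (-π) π, h θ := by
  have e := (volume_preserving_finTwoArrow ℝ).symm
  rw [← e.lintegral_comp_emb (MeasurableEquiv.measurableEmbedding _),
    ← lintegral_comp_polarCoord_symm]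
  have ht : polarCoord.target = Set.Ioi (0:ℝ) ×ˢ Set.Ioo (-π) π := rfl
  rw [ht, ← lintegral_prod_mul hg.aemeasurable hh.aemeasurable, Measure.prod_restrict]
  refine setLIntegral_mono' (measurableSet_Ioi.prod measurableSet_Ioo) ?_
  rintro ⟨r, θ⟩ hp
  exact H r θ hp.1

lemma en2_polar (r θ : ℝ) (hr : 0 < r) : en2 ![r * cos θ, r * sin θ] = r := by
  have : (r * cos θ)^2 + (r * sin θ)^2 = r^2 := by
    nlinarith [sin_sq_add_cos_sq θ]
  simp only [en2, Fin.sum_univ_two, Matrix.cons_val_zero, Matrix.cons_val_one]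
  rw [this]
  exact Real.sqrt_sq hr.le

lemma en2_cont : Continuous en2 := by
  unfold en2; fun_prop

lemma volθ : ∫⁻ _θ in Set.Ioo (-π) π, (1:ℝ≥0∞) = ENNReal.ofReal (2 * π) := by
  rw [setLIntegral_one, Real.volume_Ioo]; congr 1; ring

/-- region `|z| < ε`. -/
lemma radA (ε : ℝ) :
    ∫⁻ z in {z : R2 | en2 z < ε}, ENNReal.ofReal (1 / en2 z) ≤ ENNReal.ofReal (2 * π * ε) := by
  rw [← lintegral_indicator (measurableSet_lt en2_cont.measurable measurable_const)]
  refine (polar_le _ ((Set.Iio ε).indicator 1) 1 (measurable_one.indicator measurableSet_Iio)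
    measurable_one ?_).trans ?_
  · intro r θ hr
    by_cases h : r < ε
    · simp only [Set.indicator, Set.mem_ofPred_eq, en2_polar r θ hr, h, if_true, Set.mem_Iio,
        Pi.one_apply]
      rw [← ENNReal.ofReal_mul hr.le]
      field_simp; simp
    · simp [Set.indicator, en2_polar r θ hr, h]
  · rw [lintegral_indicator measurableSet_Iio, Measure.restrict_restrict measurableSet_Iio]
    simp only [Pi.one_apply]
    rw [volθ, mul_comm, ENNReal.ofReal_mul (by positivity : 0 ≤ 2 * π)]
    have : Set.Iio ε ∩ Set.Ioi 0 = Set.Ioo 0 ε := by ext; simp [and_comm]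
    rw [this, setLIntegral_one, Real.volume_Ioo, sub_zero]

/-- region `1 ≤ |z|`. -/
lemma radC :
    ∫⁻ z in {z : R2 | 1 ≤ en2 z}, ENNReal.ofReal (1 / en2 z ^ 3) ≤ ENNReal.ofReal (2 * π) := by
  rw [← lintegral_indicator (measurableSet_le measurable_const en2_cont.measurable)]
  refine (polar_le _ ((Set.Ici 1).indicator fun r => ENNReal.ofReal (r ^ (-2:ℝ))) 1
    (Measurable.indicator (by fun_prop) measurableSet_Ici)
    measurable_one ?_).trans ?_
  · intro r θ hr
    by_cases h : 1 ≤ r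
    · simp only [Set.indicator, Set.mem_ofPred_eq, en2_polar r θ hr, h, if_true, Set.mem_Ici,
        Pi.one_apply, mul_one]
      rw [← ENNReal.ofReal_mul hr.le]
      apply ENNReal.ofReal_le_ofReal
      rw [Real.rpow_neg hr.le, Real.rpow_two]
      field_simp; simp
    · simp [Set.indicator, en2_polar r θ hr, h]
  · rw [lintegral_indicator measurableSet_Ici, Measure.restrict_restrict measurableSet_Ici]
    simp only [Pi.one_apply]
    rw [volθ]
    have : Set.Ici (1:ℝ) ∩ Set.Ioi 0 = Set.Ici 1 := by
      ext x; simp; intro h; linarith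
    rw [this, setLIntegral_congr Ioi_ae_eq_Ici.symm, ← ofReal_integral_eq_lintegral_ofReal
      (integrableOn_Ioi_rpow_of_lt (by norm_num) one_pos)
      ((ae_restrict_iff' measurableSet_Ioi).2 (Eventually.of_forall fun x hx => by
        have : (0:ℝ) < x := lt_trans one_pos hx
        simp only [Pi.zero_apply]; positivity)),
      integral_Ioi_rpow_of_lt (by norm_num) one_pos]
    norm_num

lemma ang (a b : ℝ) :
    ∫⁻ θ in Set.Ioo (-π) π, ENNReal.ofReal |a * cos θ + b * sin θ|
      ≤ ENNReal.ofReal (4 * Real.sqrt (a ^ 2 + b ^ 2)) := by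
  have hper : Function.Periodic (fun θ => |cos θ|) π := by
    intro x; simp [cos_add_pi]
  have h4 : ∀ t : ℝ, ∫ θ in t..t + 2 * π, |cos θ| = 4 := by
    intro t
    have := hper.intervalIntegral_add_zsmul_eq 2 t (fun _ _ => (by fun_prop : Continuous fun θ => |cos θ|).intervalIntegrable _ _)
    have h2 : (2:ℤ) • π = 2 * π := by simp
    rw [h2] at this
    rw [this, hper.intervalIntegral_add_eq t (-(π/2))]
    have h3 : ∫ θ in (-(π/2))..(-(π/2) + π), |cos θ| = ∫ θ in (-(π/2))..(-(π/2) + π), cos θ := by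
      apply intervalIntegral.integral_congr
      intro x hx
      rw [Set.uIcc_of_le (by linarith [pi_pos])] at hx
      exact abs_of_nonneg (cos_nonneg_of_neg_pi_div_two_le_of_le hx.1 (by linarith [hx.2]))
    rw [h3, integral_cos]
    have : -(π/2) + π = π / 2 := by ring
    rw [this]; simp; norm_num
  obtain ⟨R, φ, hR, ha, hb⟩ : ∃ R φ : ℝ, R = Real.sqrt (a^2+b^2) ∧ a = R * cos φ ∧ b = R * sin φ := by
    refine ⟨_, Complex.arg ⟨a, b⟩, rfl, ?_, ?_⟩
    · have := Complex.norm_mul_cos_arg ⟨a, b⟩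
      rw [Complex.norm_def, Complex.normSq_mk, ← sq, ← sq] at this
      exact this.symm
    · have := Complex.norm_mul_sin_arg ⟨a, b⟩
      rw [Complex.norm_def, Complex.normSq_mk, ← sq, ← sq] at this
      exact this.symm
  have hR0 : 0 ≤ R := hR ▸ Real.sqrt_nonneg _
  rw [← hR]
  have e : ∀ θ, |a * cos θ + b * sin θ| = R * |cos (θ - φ)| := by
    intro θ
    rw [cos_sub, ha, hb, ← abs_of_nonneg hR0, ← abs_mul, abs_of_nonneg hR0]; ring_nf
  simp_rw [e]
  have hc : Continuous fun θ => R * |cos (θ - φ)| := by fun_prop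
  rw [← ofReal_integral_eq_lintegral_ofReal
    (hc.integrableOn_Icc.mono_set Set.Ioo_subset_Icc_self)
    (Eventually.of_forall fun x => by simp only [Pi.zero_apply]; positivity)]
  apply ENNReal.ofReal_le_ofReal
  rw [← integral_Ioc_eq_integral_Ioo, ← intervalIntegral.integral_of_le (by linarith [pi_pos]),
    intervalIntegral.integral_const_mul,
    intervalIntegral.integral_comp_sub_right (fun θ => |cos θ|)]
  have : π - φ = (-π - φ) + 2 * π := by ring
  rw [this, h4]; linarith

/-- region `ε ≤ |z| < 1`. -/
lemma radB (ε : ℝ) (h0 : 0 < ε) (h1 : ε < 1) (a b : ℝ) :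
    ∫⁻ z in {z : R2 | ε ≤ en2 z ∧ en2 z < 1}, ENNReal.ofReal (|a * z 0 + b * z 1| / en2 z ^ 3)
      ≤ ENNReal.ofReal (4 * |Real.log ε| * Real.sqrt (a ^ 2 + b ^ 2)) := by
  have hm : MeasurableSet {z : R2 | ε ≤ en2 z ∧ en2 z < 1} :=
    (measurableSet_le measurable_const en2_cont.measurable).inter
      (measurableSet_lt en2_cont.measurable measurable_const)
  rw [← lintegral_indicator hm]
  refine (polar_le _ ((Set.Ico ε 1).indicator fun r => ENNReal.ofReal (r⁻¹))
    (fun θ => ENNReal.ofReal |a * cos θ + b * sin θ|)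
    (Measurable.indicator (by fun_prop) measurableSet_Ico)
    (by fun_prop) ?_).trans ?_
  · intro r θ hr
    by_cases h : ε ≤ r ∧ r < 1
    · simp only [Set.indicator, Set.mem_ofPred_eq, en2_polar r θ hr, h, if_true, Set.mem_Ico,
        and_self]
      rw [← ENNReal.ofReal_mul hr.le, ← ENNReal.ofReal_mul (by positivity)]
      apply ENNReal.ofReal_le_ofReal
      apply le_of_eq
      simp only [Matrix.cons_val_zero, Matrix.cons_val_one]
      have : a * (r * cos θ) + b * (r * sin θ) = r * (a * cos θ + b * sin θ) := by ring
      rw [this, abs_mul, abs_of_pos hr]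
      field_simp
    · simp [Set.indicator, en2_polar r θ hr, h]
  · rw [lintegral_indicator measurableSet_Ico, Measure.restrict_restrict measurableSet_Ico]
    have : Set.Ico ε 1 ∩ Set.Ioi 0 = Set.Ico ε 1 := by
      ext x; simp; intro h _; linarith
    have hlog : Real.log ε < 0 := Real.log_neg h0 h1
    have hi : IntervalIntegrable (fun r : ℝ => r⁻¹) volume ε 1 := by
      apply intervalIntegral.intervalIntegrable_inv
      · intro x hx; rw [Set.uIcc_of_le h1.le] at hx; linarith [hx.1]
      · fun_prop
    rw [this, setLIntegral_congr Ico_ae_eq_Ioc, ← ofReal_integral_eq_lintegral_ofReal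
      ((intervalIntegrable_iff_integrableOn_Ioc_of_le h1.le).1 hi)
      ((ae_restrict_iff' measurableSet_Ioc).2 (Eventually.of_forall fun x hx => by
        have : (0:ℝ) < x := lt_trans h0 hx.1
        simp only [Pi.zero_apply]; positivity)),
      ← intervalIntegral.integral_of_le h1.le, integral_inv_of_pos h0 one_pos]
    have : Real.log (1 / ε) = |Real.log ε| := by rw [abs_of_neg hlog]; simp
    rw [this]
    refine (mul_le_mul_right (ang a b) _).trans ?_
    rw [← ENNReal.ofReal_mul (by positivity)]
    apply ENNReal.ofReal_le_ofReal; linarith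

lemma cube_fund : IsAddFundamentalDomain
    (Submodule.span ℤ (Set.range (Pi.basisFun ℝ (Fin 2)))) cube volume := by
  have := ZSpan.isAddFundamentalDomain (Pi.basisFun ℝ (Fin 2)) volume
  rwa [ZSpan.fundamentalDomain_pi_basisFun] at this

lemma cube_meas : MeasurableSet cube :=
  MeasurableSet.univ_pi fun _ => measurableSet_Ico

instance : VAddInvariantMeasure (Submodule.span ℤ (Set.range (Pi.basisFun ℝ (Fin 2)))) R2 volume :=
  ⟨fun c s _ => measure_preimage_add volume (c : R2) s⟩

lemma cube_transl (F : R2 → ℝ≥0∞)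
    (hF : ∀ (x : R2) (n : Fin 2 → ℤ), F (x + fun i => (n i : ℝ)) = F x) (w : R2) :
    ∫⁻ x in cube, F (x + w) = ∫⁻ x in cube, F x := by
  have h2 : IsAddFundamentalDomain
      (Submodule.span ℤ (Set.range (Pi.basisFun ℝ (Fin 2)))) (w +ᵥ cube) volume :=
    cube_fund.vadd_of_comm w
  rw [IsAddFundamentalDomain.setLIntegral_eq cube_fund h2 F]
  · have hp : MeasurePreserving (fun x : R2 => x + w) volume volume :=
      measurePreserving_add_right volume w
    rw [← hp.setLIntegral_comp_preimage_emb (measurableEmbedding_addRight w) F (w +ᵥ cube)]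
    congr 2
    ext x
    rw [Set.mem_preimage, Set.mem_vadd_set]
    constructor
    · intro h; exact ⟨x, h, add_comm w x⟩
    · rintro ⟨y, hy, h⟩
      rw [vadd_eq_add, add_comm, add_left_inj] at h
      exact h ▸ hy
  · rintro ⟨g, hg⟩ x
    rw [Module.Basis.mem_span_iff_repr_mem] at hg
    choose n hn using hg
    have : (⟨g, hg⟩ : Submodule.span ℤ (Set.range (Pi.basisFun ℝ (Fin 2)))) +ᵥ x = x + fun i => (n i : ℝ) := by
      ext i
      have := hn i
      simp at this
      simp [Submodule.vadd_def, this, add_comm]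
    rw [this, hF]

lemma cube_sub : cube ⊆ Set.Icc 0 1 := by
  intro x hx
  exact ⟨fun i => (hx i trivial).1, fun i => (hx i trivial).2.le⟩

lemma cube_int (F : R2 → ℝ) (hF : Continuous F) : IntegrableOn F cube :=
  hF.integrableOn_Icc.mono_set cube_sub

lemma cube_ofReal (F : R2 → ℝ) (hF : Continuous F) (h0 : ∀ x, 0 ≤ F x) :
    ∫⁻ x in cube, ENNReal.ofReal (F x) = ENNReal.ofReal (∫ x in cube, F x) :=
  (ofReal_integral_eq_lintegral_ofReal (cube_int F hF) (Eventually.of_forall h0)).symm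

lemma cube_avg (F : R2 → ℝ) (hF : Continuous F) (h0 : ∀ x, 0 ≤ F x)
    (hper : ∀ (x : R2) (n : Fin 2 → ℤ), F (x + fun i => (n i : ℝ)) = F x) (z : R2) :
    ∫⁻ x in cube, ENNReal.ofReal (∫ t in (0:ℝ)..1, F (x + t • z))
      = ∫⁻ x in cube, ENNReal.ofReal (F x) := by
  have e : ∀ x : R2, ENNReal.ofReal (∫ t in (0:ℝ)..1, F (x + t • z))
      = ∫⁻ t in Set.Ioc (0:ℝ) 1, ENNReal.ofReal (F (x + t • z)) := by
    intro x
    have hc : Continuous fun t : ℝ => F (x + t • z) := by fun_prop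
    rw [intervalIntegral.integral_of_le zero_le_one]
    exact ofReal_integral_eq_lintegral_ofReal
      (hc.integrableOn_Icc.mono_set Set.Ioc_subset_Icc_self) (Eventually.of_forall fun t => h0 _)
  simp_rw [e]
  rw [lintegral_lintegral_swap]
  · have : ∀ t : ℝ, ∫⁻ x in cube, ENNReal.ofReal (F (x + t • z))
        = ∫⁻ x in cube, ENNReal.ofReal (F x) := fun t =>
      cube_transl (fun x => ENNReal.ofReal (F x)) (fun x n => by rw [hper]) _
    simp_rw [this]
    simp
  · apply Measurable.aemeasurable
    apply ENNReal.measurable_ofReal.comp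
    apply Continuous.measurable
    fun_prop

section diff
variable {f : R2 → ℝ} (hf : ContDiff ℝ 1 f)
  (hper : ∀ (x : R2) (n : Fin 2 → ℤ), f (x + fun i => (n i : ℝ)) = f x)

lemma D_per (hper : ∀ (x : R2) (n : Fin 2 → ℤ), f (x + fun i => (n i : ℝ)) = f x)
    (x : R2) (n : Fin 2 → ℤ) : fderiv ℝ f (x + fun i => (n i : ℝ)) = fderiv ℝ f x := by
  rw [← fderiv_comp_add_right]
  congr 1
  ext y; exact hper y n

lemma D_cont (hf : ContDiff ℝ 1 f) (z : R2) : Continuous fun x => fderiv ℝ f x z :=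
  (hf.continuous_fderiv (by norm_num)).clm_apply continuous_const

lemma ftc (hf : ContDiff ℝ 1 f) (x z : R2) :
    f (x + z) - f x = ∫ t in (0:ℝ)..1, fderiv ℝ f (x + t • z) z := by
  rw [intervalIntegral.integral_eq_sub_of_hasDerivAt (f := fun t : ℝ => f (x + t • z))]
  · simp
  · intro t _
    have h1 : HasDerivAt (fun t : ℝ => x + t • z) z t := by
      simpa using ((hasDerivAt_id t).smul_const z).const_add x
    exact (hf.differentiable (by norm_num) _).hasFDerivAt.comp_hasDerivAt t h1
  · have := (D_cont hf z).comp (by fun_prop : Continuous fun t : ℝ => x + t • z)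
    exact this.intervalIntegrable _ _

lemma bound1 (hf : ContDiff ℝ 1 f)
    (hper : ∀ (x : R2) (n : Fin 2 → ℤ), f (x + fun i => (n i : ℝ)) = f x) (z : R2) :
    ∫⁻ x in cube, ENNReal.ofReal |f (x + z) - f x|
      ≤ ∫⁻ x in cube, ENNReal.ofReal |fderiv ℝ f x z| := by
  rw [← cube_avg (fun x => |fderiv ℝ f x z|) (D_cont hf z).abs (fun _ => abs_nonneg _)
    (fun x n => by rw [D_per hper]) z]
  refine lintegral_mono fun x => ENNReal.ofReal_le_ofReal ?_
  rw [ftc hf]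
  exact intervalIntegral.abs_integral_le_integral_abs zero_le_one

lemma bound2 (hf : ContDiff ℝ 1 f)
    (hper : ∀ (x : R2) (n : Fin 2 → ℤ), f (x + fun i => (n i : ℝ)) = f x) (z : R2) :
    ∫⁻ x in cube, ENNReal.ofReal ((f (x + z) - f x) ^ 2)
      ≤ ∫⁻ x in cube, ENNReal.ofReal ((fderiv ℝ f x z) ^ 2) := by
  rw [← cube_avg (fun x => (fderiv ℝ f x z) ^ 2) ((D_cont hf z).pow 2) (fun _ => sq_nonneg _)
    (fun x n => by rw [D_per hper]) z]
  refine lintegral_mono fun x => ENNReal.ofReal_le_ofReal ?_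
  have hc : Continuous fun t : ℝ => fderiv ℝ f (x + t • z) z :=
    (D_cont hf z).comp (by fun_prop : Continuous fun t : ℝ => x + t • z)
  have h1 := ftc hf x z
  set a := f (x + z) - f x
  have h2 : 0 ≤ ∫ t in (0:ℝ)..1, (fderiv ℝ f (x + t • z) z - a) ^ 2 :=
    intervalIntegral.integral_nonneg zero_le_one fun _ _ => sq_nonneg _
  have h3 : ∫ t in (0:ℝ)..1, (fderiv ℝ f (x + t • z) z - a) ^ 2
      = (∫ t in (0:ℝ)..1, (fderiv ℝ f (x + t • z) z) ^ 2) - a ^ 2 := by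
    have : ∀ t : ℝ, (fderiv ℝ f (x + t • z) z - a) ^ 2
      = (fderiv ℝ f (x + t • z) z) ^ 2 - (2 * a * fderiv ℝ f (x + t • z) z - a ^ 2) := by
      intro t; ring
    simp_rw [this]
    rw [intervalIntegral.integral_sub ((by fun_prop : Continuous fun t : ℝ => (fderiv ℝ f (x + t • z) z) ^ 2).intervalIntegrable _ _)
      ((by fun_prop : Continuous fun t : ℝ => 2 * a * fderiv ℝ f (x + t • z) z - a ^ 2).intervalIntegrable _ _),
      intervalIntegral.integral_sub ((hc.const_mul _).intervalIntegrable _ _) (by simp),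
      intervalIntegral.integral_const_mul, ← h1]
    simp; ring
  linarith

lemma D_coord (x z : R2) : fderiv ℝ f x z =
    fderiv ℝ f x (Pi.single 0 1) * z 0 + fderiv ℝ f x (Pi.single 1 1) * z 1 := by
  have : z = z 0 • (Pi.single 0 1 : R2) + z 1 • (Pi.single 1 1 : R2) := by
    ext i; fin_cases i <;> simp
  conv_lhs => rw [this]
  rw [map_add, map_smul, map_smul, smul_eq_mul, smul_eq_mul]; ring

lemma gns (x : R2) : gradNormSq f x =
    fderiv ℝ f x (Pi.single 0 1) ^ 2 + fderiv ℝ f x (Pi.single 1 1) ^ 2 := by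
  simp [gradNormSq, Fin.sum_univ_two]

lemma gns_nonneg (x : R2) : 0 ≤ gradNormSq f x := by rw [gns]; positivity

lemma gns_cont (hf : ContDiff ℝ 1 f) : Continuous (gradNormSq f) := by
  unfold gradNormSq
  exact continuous_finsetSum _ fun j _ => (D_cont hf _).pow 2

lemma gn_cont (hf : ContDiff ℝ 1 f) : Continuous (gradNorm f) :=
  (gns_cont hf).sqrt

lemma en2_sq (z : R2) : en2 z ^ 2 = z 0 ^ 2 + z 1 ^ 2 := by
  unfold en2
  rw [Real.sq_sqrt (Finset.sum_nonneg fun i _ => sq_nonneg _), Fin.sum_univ_two]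

lemma en2_nonneg (z : R2) : 0 ≤ en2 z := Real.sqrt_nonneg _

lemma D_sq_le (x z : R2) : (fderiv ℝ f x z) ^ 2 ≤ gradNormSq f x * en2 z ^ 2 := by
  rw [D_coord, gns, en2_sq]
  nlinarith [sq_nonneg (fderiv ℝ f x (Pi.single 0 1) * z 1 - fderiv ℝ f x (Pi.single 1 1) * z 0)]

/-- Bound on the double integral. -/
lemma main_bound (hf : ContDiff ℝ 1 f)
    (hper : ∀ (x : R2) (n : Fin 2 → ℤ), f (x + fun i => (n i : ℝ)) = f x)
    (hb : ∀ x, |f x| ≤ 1) (ε : ℝ) (h0 : 0 < ε) (h1 : ε < 1) :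
    ∫ x in cube, ∫ z : R2, (f (x + z) - f x) ^ 2 / en2 z ^ 3
      ≤ 2 * π * ε * (∫ x in cube, gradNormSq f x)
        + (8 * |Real.log ε| + 8 * π) * (∫ x in cube, gradNorm f x) := by
  have hfc : Continuous f := hf.continuous
  set Q := ∫ x in cube, gradNormSq f x with hQ
  set G := ∫ x in cube, gradNorm f x with hG
  have hQ0 : 0 ≤ Q := integral_nonneg fun x => gns_nonneg x
  have hG0 : 0 ≤ G := integral_nonneg fun x => Real.sqrt_nonneg _
  have hQe := cube_ofReal _ (gns_cont hf) gns_nonneg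
  have hGe := cube_ofReal _ (gn_cont hf) (fun x => Real.sqrt_nonneg _)
  have hnn : ∀ x z : R2, 0 ≤ (f (x + z) - f x) ^ 2 / en2 z ^ 3 := fun x z =>
    div_nonneg (sq_nonneg _) (pow_nonneg (en2_nonneg z) 3)
  rw [← ENNReal.ofReal_le_ofReal_iff (by positivity)]
  have s1 : ENNReal.ofReal (∫ x in cube, ∫ z : R2, (f (x + z) - f x) ^ 2 / en2 z ^ 3)
      ≤ ∫⁻ x in cube, ∫⁻ z : R2, ENNReal.ofReal ((f (x + z) - f x) ^ 2 / en2 z ^ 3) := by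
    rw [← Real.enorm_of_nonneg (integral_nonneg fun x => integral_nonneg fun z => hnn x z)]
    refine (enorm_integral_le_lintegral_enorm _).trans (lintegral_mono fun x => ?_)
    refine (enorm_integral_le_lintegral_enorm _).trans (lintegral_mono fun z => ?_)
    rw [Real.enorm_of_nonneg (hnn x z)]
  refine s1.trans ?_
  have en2m : Measurable en2 := en2_cont.measurable
  rw [lintegral_lintegral_swap (by
    apply Measurable.aemeasurable
    apply ENNReal.measurable_ofReal.comp
    apply Measurable.div
    · apply Continuous.measurable; fun_prop
    · exact (en2m.comp measurable_snd).pow_const 3)]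
  set A : Set R2 := {z | en2 z < ε} with hA
  set B : Set R2 := {z | ε ≤ en2 z ∧ en2 z < 1} with hB
  set C : Set R2 := {z | 1 ≤ en2 z} with hC
  have mA : MeasurableSet A := measurableSet_lt en2m measurable_const
  have mC : MeasurableSet C := measurableSet_le measurable_const en2m
  have mB : MeasurableSet B :=
    (measurableSet_le measurable_const en2m).inter (measurableSet_lt en2m measurable_const)
  have hU : (Set.univ : Set R2) = A ∪ (B ∪ C) := by
    ext z
    simp only [Set.mem_univ, true_iff, hA, hB, hC, Set.mem_union, Set.mem_ofPred_eq]
    by_cases q1 : en2 z < ε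
    · exact Or.inl q1
    · by_cases q2 : en2 z < 1
      · exact Or.inr (Or.inl ⟨not_lt.1 q1, q2⟩)
      · exact Or.inr (Or.inr (not_lt.1 q2))
  rw [← setLIntegral_univ, hU]
  have split : ∀ (k : ℝ) (_ : 0 ≤ k) (H : R2 → ℝ) (_ : ∀ x, 0 ≤ H x),
      ∫⁻ x in cube, ENNReal.ofReal (H x / k)
        = (∫⁻ x in cube, ENNReal.ofReal (H x)) * ENNReal.ofReal (1 / k) := by
    intro k hk H hH
    rw [← lintegral_mul_const' _ _ ENNReal.ofReal_ne_top]
    refine lintegral_congr fun x => ?_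
    rw [← ENNReal.ofReal_mul (hH x), mul_one_div]
  have sqle : ∀ z : R2, ∫⁻ x in cube, ENNReal.ofReal ((f (x + z) - f x) ^ 2)
      ≤ 2 * ∫⁻ x in cube, ENNReal.ofReal |f (x + z) - f x| := by
    intro z
    rw [← lintegral_const_mul' _ _ (by norm_num)]
    refine lintegral_mono fun x => ?_
    have e2 : (2:ℝ≥0∞) = ENNReal.ofReal 2 := by simp
    rw [e2, ← ENNReal.ofReal_mul (by norm_num)]
    apply ENNReal.ofReal_le_ofReal
    have : |f (x + z) - f x| ≤ 2 := by
      have a1 := abs_le.1 (hb (x+z)); have a2 := abs_le.1 (hb x)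
      rw [abs_le]; constructor <;> linarith
    rw [← sq_abs]; nlinarith [abs_nonneg (f (x + z) - f x)]
  have pA : ∫⁻ z in A, ∫⁻ x in cube, ENNReal.ofReal ((f (x + z) - f x) ^ 2 / en2 z ^ 3)
      ≤ ENNReal.ofReal (2 * π * ε * Q) := by
    have : ∀ z : R2, ∫⁻ x in cube, ENNReal.ofReal ((f (x + z) - f x) ^ 2 / en2 z ^ 3)
        ≤ ENNReal.ofReal Q * ENNReal.ofReal (1 / en2 z) := by
      intro z
      rcases (en2_nonneg z).eq_or_lt with hz | hz
      · simp [← hz]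
      rw [split _ (pow_nonneg (en2_nonneg z) 3) _ (fun x => sq_nonneg _)]
      refine (mul_le_mul_left (bound2 hf hper z) _).trans ?_
      rw [← split _ (pow_nonneg (en2_nonneg z) 3) _ (fun x => sq_nonneg _), ← hQe,
        ← split _ (en2_nonneg z) _ gns_nonneg]
      refine lintegral_mono fun x => ENNReal.ofReal_le_ofReal ?_
      rw [div_le_div_iff₀ (by positivity) hz]
      nlinarith [mul_le_mul_of_nonneg_right (D_sq_le (f := f) x z) hz.le]
    refine (lintegral_mono this).trans ?_
    rw [lintegral_const_mul' _ _ ENNReal.ofReal_ne_top]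
    refine (mul_le_mul_right (radA ε) _).trans ?_
    rw [← ENNReal.ofReal_mul hQ0, mul_comm]
  have pC : ∫⁻ z in C, ∫⁻ x in cube, ENNReal.ofReal ((f (x + z) - f x) ^ 2 / en2 z ^ 3)
      ≤ ENNReal.ofReal (8 * π * G) := by
    have : ∀ z : R2, ∫⁻ x in cube, ENNReal.ofReal ((f (x + z) - f x) ^ 2 / en2 z ^ 3)
        ≤ ENNReal.ofReal (4 * G) * ENNReal.ofReal (1 / en2 z ^ 3) := by
      intro z
      rw [split _ (pow_nonneg (en2_nonneg z) 3) _ (fun x => sq_nonneg _)]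
      refine mul_le_mul_left ?_ _
      set w : R2 := fun i => Int.fract (z i) with hw
      have hzw : ∀ x, f (x + z) = f (x + w) := by
        intro x
        rw [← hper (x + w) fun i => ⌊z i⌋]
        congr 1
        ext i
        simp only [hw, Pi.add_apply]
        linarith [Int.fract_add_floor (z i)]
      simp_rw [hzw]
      refine ((sqle w).trans (mul_le_mul_right (bound1 hf hper w) _)).trans ?_
      have e4 : ENNReal.ofReal (4 * G) = 2 * (2 * ENNReal.ofReal G) := by
        rw [ENNReal.ofReal_mul (by norm_num), ← mul_assoc]; norm_num
      rw [e4]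
      refine mul_le_mul_right ?_ _
      rw [← hGe, ← lintegral_const_mul' _ _ (by norm_num)]
      refine lintegral_mono fun x => ?_
      have e2 : (2:ℝ≥0∞) = ENNReal.ofReal 2 := by simp
      rw [e2, ← ENNReal.ofReal_mul (by norm_num)]
      apply ENNReal.ofReal_le_ofReal
      have w0 : 0 ≤ w 0 ∧ w 0 < 1 := ⟨Int.fract_nonneg _, Int.fract_lt_one _⟩
      have w1 : 0 ≤ w 1 ∧ w 1 < 1 := ⟨Int.fract_nonneg _, Int.fract_lt_one _⟩
      apply abs_le_of_sq_le_sq _ (by unfold gradNorm; positivity)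
      unfold gradNorm
      rw [mul_pow, Real.sq_sqrt (gns_nonneg x)]
      refine (D_sq_le x w).trans ?_
      rw [mul_comm]
      refine mul_le_mul_of_nonneg_right ?_ (gns_nonneg x)
      rw [en2_sq]; nlinarith
    refine (lintegral_mono this).trans ?_
    rw [lintegral_const_mul' _ _ ENNReal.ofReal_ne_top]
    refine (mul_le_mul_right radC _).trans ?_
    rw [← ENNReal.ofReal_mul (by positivity)]
    apply ENNReal.ofReal_le_ofReal; linarith
  have pB : ∫⁻ z in B, ∫⁻ x in cube, ENNReal.ofReal ((f (x + z) - f x) ^ 2 / en2 z ^ 3)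
      ≤ ENNReal.ofReal (8 * |Real.log ε| * G) := by
    have : ∀ z : R2, ∫⁻ x in cube, ENNReal.ofReal ((f (x + z) - f x) ^ 2 / en2 z ^ 3)
        ≤ 2 * ∫⁻ x in cube, ENNReal.ofReal (|fderiv ℝ f x z| / en2 z ^ 3) := by
      intro z
      rw [split _ (pow_nonneg (en2_nonneg z) 3) _ (fun x => sq_nonneg _),
        split _ (pow_nonneg (en2_nonneg z) 3) _ (fun x => abs_nonneg _), ← mul_assoc]
      exact mul_le_mul_left ((sqle z).trans (mul_le_mul_right (bound1 hf hper z) _)) _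
    refine (lintegral_mono this).trans ?_
    rw [lintegral_const_mul' _ _ (by norm_num), lintegral_lintegral_swap (by
      apply Measurable.aemeasurable
      apply ENNReal.measurable_ofReal.comp
      apply Measurable.div
      · apply Continuous.measurable
        exact (((hf.continuous_fderiv (by norm_num)).comp continuous_snd).clm_apply
          continuous_fst).abs
      · exact (en2m.comp measurable_fst).pow_const 3)]
    have hx : ∀ x : R2, ∫⁻ z in B, ENNReal.ofReal (|fderiv ℝ f x z| / en2 z ^ 3)
        ≤ ENNReal.ofReal (4 * |Real.log ε|) * ENNReal.ofReal (gradNorm f x) := by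
      intro x
      have := radB ε h0 h1 (fderiv ℝ f x (Pi.single 0 1)) (fderiv ℝ f x (Pi.single 1 1))
      simp_rw [← D_coord, ← gns] at this
      rwa [ENNReal.ofReal_mul (by positivity)] at this
    refine (mul_le_mul_right (lintegral_mono hx) _).trans ?_
    rw [lintegral_const_mul' _ _ ENNReal.ofReal_ne_top, hGe, ← ENNReal.ofReal_mul (by positivity)]
    have e2 : (2:ℝ≥0∞) = ENNReal.ofReal 2 := by simp
    rw [e2, ← ENNReal.ofReal_mul (by norm_num)]
    apply ENNReal.ofReal_le_ofReal; linarith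
  refine (lintegral_union_le _ _ _).trans ((add_le_add pA
    ((lintegral_union_le _ _ _).trans (add_le_add pB pC))).trans ?_)
  rw [← ENNReal.ofReal_add (by positivity) (by positivity),
    ← ENNReal.ofReal_add (by positivity) (by positivity)]
  apply ENNReal.ofReal_le_ofReal; linarith

end diff

lemma pointwise (m : R2 → R3) (hm : Mag m) (ε : ℝ) (h0 : 0 < ε) (x : R2) :
    gradNormSq (fun y => m y 2) x ≤ gradVSq m x ∧
    gradNorm (fun y => m y 2) x ≤ ε / 2 * gradVSq m x + (1 - (m x 2) ^ 2) / (2 * ε) := by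
  obtain ⟨hc, -, hs⟩ := hm
  have hd : DifferentiableAt ℝ m x := hc.differentiable (by norm_num) x
  have hdi : ∀ i, HasFDerivAt (fun y => m y i)
      ((ContinuousLinearMap.proj i).comp (fderiv ℝ m x)) x := fun i =>
    hasFDerivAt_pi'.1 hd.hasFDerivAt i
  have h2 : fderiv ℝ (fun y => m y 2) x = (ContinuousLinearMap.proj 2).comp (fderiv ℝ m x) :=
    (hdi 2).fderiv
  have orth : ∀ v : R2, m x 0 * fderiv ℝ m x v 0 + m x 1 * fderiv ℝ m x v 1
      + m x 2 * fderiv ℝ m x v 2 = 0 := by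
    intro v
    have hsum := (((hdi 0).pow 2).add ((hdi 1).pow 2)).add ((hdi 2).pow 2)
    have hconst : HasFDerivAt (fun y => (m y 0) ^ 2 + (m y 1)^2 + (m y 2)^2)
        (0 : R2 →L[ℝ] ℝ) x := by
      have : (fun y => (m y 0) ^ 2 + (m y 1)^2 + (m y 2)^2) = fun _ => (1:ℝ) := by
        ext y; rw [← hs y, Fin.sum_univ_three]
      rw [this]; exact hasFDerivAt_const _ _
    have := congrArg (fun L : R2 →L[ℝ] ℝ => L v) (hsum.unique hconst)
    simp at this
    linarith
  have hs' : m x 0 ^ 2 + m x 1 ^ 2 + m x 2 ^ 2 = 1 := by rw [← hs x, Fin.sum_univ_three]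
  have key : ∀ v : R2, (fderiv ℝ m x v 2) ^ 2 ≤ (1 - m x 2 ^ 2) *
      (fderiv ℝ m x v 0 ^ 2 + fderiv ℝ m x v 1 ^ 2 + fderiv ℝ m x v 2 ^ 2) := by
    intro v
    have o := orth v
    generalize fderiv ℝ m x v 0 = p at *
    generalize fderiv ℝ m x v 1 = q at *
    generalize fderiv ℝ m x v 2 = r at *
    have e1 : 1 - m x 2 ^ 2 = m x 0 ^ 2 + m x 1 ^ 2 := by linarith
    have e2 : (m x 2 * r) ^ 2 = (m x 0 * p + m x 1 * q) ^ 2 := by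
      have : m x 2 * r = - (m x 0 * p + m x 1 * q) := by linarith
      rw [this]; ring
    have e3 : r ^ 2 = (m x 2 * r) ^ 2 + (1 - m x 2 ^ 2) * r ^ 2 := by ring
    rw [e2, e1] at e3
    rw [e1]
    nlinarith [sq_nonneg (m x 0 * q - m x 1 * p)]
  have hV : gradVSq m x = ∑ j : Fin 2, (fderiv ℝ m x (Pi.single j 1) 0 ^ 2
      + fderiv ℝ m x (Pi.single j 1) 1 ^ 2 + fderiv ℝ m x (Pi.single j 1) 2 ^ 2) := by
    unfold gradVSq
    simp_rw [Fin.sum_univ_three]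
  have hN : gradNormSq (fun y => m y 2) x = ∑ j : Fin 2, fderiv ℝ m x (Pi.single j 1) 2 ^ 2 := by
    unfold gradNormSq; rw [h2]; rfl
  have hNV : gradNormSq (fun y => m y 2) x ≤ (1 - m x 2 ^ 2) * gradVSq m x := by
    rw [hN, hV, Finset.mul_sum]
    exact Finset.sum_le_sum fun j _ => key _
  have ha : 0 ≤ 1 - m x 2 ^ 2 := by nlinarith [sq_nonneg (m x 0), sq_nonneg (m x 1)]
  have hV0 : 0 ≤ gradVSq m x := by
    rw [hV]; exact Finset.sum_nonneg fun j _ => by positivity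
  refine ⟨?_, ?_⟩
  · rw [hN, hV]
    exact Finset.sum_le_sum fun j _ => by nlinarith [sq_nonneg (fderiv ℝ m x (Pi.single j 1) 0), sq_nonneg (fderiv ℝ m x (Pi.single j 1) 1)]
  · unfold gradNorm
    rw [Real.sqrt_le_left (by positivity)]
    refine hNV.trans ?_
    have : (1 - m x 2 ^ 2) * gradVSq m x
        = 4 * (ε / 2 * gradVSq m x) * ((1 - (m x 2) ^ 2) / (2 * ε)) := by
      field_simp; ring
    rw [this]
    nlinarith [sq_nonneg (ε / 2 * gradVSq m x - (1 - (m x 2) ^ 2) / (2 * ε))]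

lemma gradV_cont (m : R2 → R3) (hc : ContDiff ℝ 1 m) : Continuous (gradVSq m) := by
  unfold gradVSq
  refine continuous_finsetSum _ fun j _ => continuous_finsetSum _ fun i _ => ?_
  exact ((continuous_apply i).comp
    ((hc.continuous_fderiv (by norm_num)).clm_apply continuous_const)).pow 2

/-- lower bound `eq:F_SUBcrit_lb`: a universal constant `c > 0` such that
for small `ε` and `λ ≤ λ_c = π/2` the energy dominates a multiple of `∫|∇m₃|`. -/
theorem stmt_9 :
    ∃ c : ℝ, 0 < c ∧ ∃ ε₀ : ℝ, 0 < ε₀ ∧ ε₀ < 1 ∧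
      ∀ ε : ℝ, 0 < ε → ε < ε₀ →
        ∀ lam : ℝ, 0 ≤ lam → lam ≤ π / 2 →
          ∀ m : R2 → R3, Mag m →
            (1 - lam * |Real.log (c * ε)| / (π / 2 * |Real.log ε|)) *
                (∫ x in cube, gradNorm (fun y => m y 2) x)
              ≤ Fen ε lam m := by
  refine ⟨exp (-(2 * π)), exp_pos _, exp (-2), exp_pos _, by
    rw [Real.exp_lt_one_iff]; norm_num, ?_⟩
  intro ε h0 hε lam hl0 hl1 m hm
  have hlog : Real.log ε < -2 := by rwa [Real.log_lt_iff_lt_exp h0]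
  have h1 : ε < 1 := hε.trans (by rw [Real.exp_lt_one_iff]; norm_num)
  have hpi := pi_pos
  have hlogc : |Real.log (exp (-(2 * π)) * ε)| = |Real.log ε| + 2 * π := by
    rw [Real.log_mul (exp_pos _).ne' h0.ne', Real.log_exp, abs_of_neg (by linarith),
      abs_of_neg (by linarith : Real.log ε < 0)]
    ring
  have hL : 2 < |Real.log ε| := by rw [abs_of_neg (by linarith)]; linarith
  rw [hlogc]
  have hc := hm.1
  have hf : ContDiff ℝ 1 (fun y => m y 2) := contDiff_pi.1 hc 2
  have hb : ∀ x, |m x 2| ≤ 1 := by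
    intro x
    have := hm.2.2 x
    rw [Fin.sum_univ_three] at this
    rw [abs_le_one_iff_mul_self_le_one]
    nlinarith [sq_nonneg (m x 0), sq_nonneg (m x 1)]
  have hH := main_bound hf (fun x n => by rw [hm.2.1 x n]) hb ε h0 h1
  have hEc : Continuous fun x => ε / 2 * gradVSq m x + (1 - (m x 2) ^ 2) / (2 * ε) := by
    have := gradV_cont m hc
    have := hf.continuous
    fun_prop
  have hGE : ∫ x in cube, gradNorm (fun y => m y 2) x
      ≤ ∫ x in cube, (ε / 2 * gradVSq m x + (1 - (m x 2) ^ 2) / (2 * ε)) :=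
    integral_mono (cube_int _ (gn_cont hf)) (cube_int _ hEc) fun x => (pointwise m hm ε h0 x).2
  have hQE : ε / 2 * ∫ x in cube, gradNormSq (fun y => m y 2) x
      ≤ ∫ x in cube, (ε / 2 * gradVSq m x + (1 - (m x 2) ^ 2) / (2 * ε)) := by
    rw [← integral_const_mul]
    refine integral_mono (cube_int _ ((gns_cont hf).const_mul _)) (cube_int _ hEc) fun x => ?_
    have p1 := (pointwise m hm ε h0 x).1
    have p2 : 0 ≤ (1 - (m x 2) ^ 2) / (2 * ε) := by
      have := abs_le.1 (hb x)
      apply div_nonneg _ (by positivity)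
      nlinarith
    have := mul_le_mul_of_nonneg_left p1 (by positivity : 0 ≤ ε / 2)
    simp only
    linarith
  have hG0 : 0 ≤ ∫ x in cube, gradNorm (fun y => m y 2) x :=
    integral_nonneg fun x => Real.sqrt_nonneg _
  unfold Fen H12
  generalize (∫ x in cube, gradNorm (fun y => m y 2) x) = G at *
  generalize (∫ x in cube, (ε / 2 * gradVSq m x + (1 - (m x 2) ^ 2) / (2 * ε))) = E at *
  generalize (∫ x in cube, gradNormSq (fun y => m y 2) x) = Q at *
  generalize (∫ x in cube, ∫ z : R2, ((fun x => m x 2) (x + z) - (fun x => m x 2) x) ^ 2 / en2 z ^ 3) = I at *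
  generalize |Real.log ε| = L at *
  have hI : I / 8 ≤ L * E + 2 * π * G := by
    have a1 : π * (ε / 2 * Q) ≤ π * E := mul_le_mul_of_nonneg_left hQE hpi.le
    have a2 : (L - π / 2) * G ≤ (L - π / 2) * E :=
      mul_le_mul_of_nonneg_left hGE (by linarith [pi_lt_four])
    have a3 : 0 ≤ π * G := by positivity
    nlinarith
  have hLp : 0 < L := by linarith
  have hs0 : 0 ≤ lam / (π / 2) := by positivity
  have hs1 : lam / (π / 2) ≤ 1 := by rw [div_le_one (by positivity)]; exact hl1
  have hlam : lam = lam / (π / 2) * (π / 2) := by field_simp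
  generalize lam / (π / 2) = s at *
  have r1 : lam * (L + 2 * π) / (π / 2 * L) = s * (1 + 2 * π / L) := by
    rw [hlam]; field_simp
  have r2 : lam / L * (1 / (4 * π) * I) = s * (I / 8 / L) := by
    rw [hlam]; field_simp; ring
  rw [r1, r2]
  have hI2 : I / 8 / L ≤ E + 2 * π / L * G := by
    rw [div_le_iff₀ hLp]
    refine hI.trans (le_of_eq ?_)
    field_simp
  have b1 := mul_le_mul_of_nonneg_left hI2 hs0
  have b2 : 0 ≤ (1 - s) * (E - G) := mul_nonneg (by linarith) (by linarith)
  nlinarith
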